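/- Let A be an n×n sign pattern of cycle form such that every directed 2-cycle of D(A) is negative and a_{i,i+1} = + for all i (indices modulo n). If a_{ii} ∈ {-, 0} for every vertex i that is covered by a negative directed 2-cycle of D(A), and a_{ii} = + for some i, then A requires algebraic positivity. -/

import Mathlib

open Matrix

/-- A real square matrix is algebraically positive if some real polynomial
evaluated at it has all entries positive. -/
def AlgPositive {n : ℕ} (M : Matrix (Fin n) (Fin n) ℝ) : Prop :=
  ∃ f : Polynomial ℝ, ∀ i j, 0 < Polynomial.aeval M f i j

/-- `B` belongs to the qualitative class of the sign pattern `A`. -/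
def InQClass {n : ℕ} (A : Matrix (Fin n) (Fin n) SignType)
    (B : Matrix (Fin n) (Fin n) ℝ) : Prop :=
  ∀ i j, SignType.sign (B i j) = A i j

/-- The sign pattern `A` requires algebraic positivity. -/
def RequiresAP {n : ℕ} (A : Matrix (Fin n) (Fin n) SignType) : Prop :=
  ∀ B : Matrix (Fin n) (Fin n) ℝ, InQClass A B → AlgPositive B

/-- An `n × n` sign pattern (indices read modulo `n`) is of cycle form if off-diagonal
entries away from the cycle `(0, 1, …, n-1, 0)` vanish and every edge of the cycle
carries at least one nonzero arc. -/
def CycleForm {n : ℕ} [NeZero n] (A : Matrix (Fin n) (Fin n) SignType) : Prop :=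
  (∀ i j : Fin n, i ≠ j → j ≠ i + 1 → i ≠ j + 1 → A i j = 0) ∧
  (∀ i : Fin n, A i (i + 1) ≠ 0 ∨ A (i + 1) i ≠ 0)

/-- For a cycle-form pattern, `D(A_+)` contains a directed cycle of length `n`. -/
def PlusNCycle {n : ℕ} [NeZero n] (A : Matrix (Fin n) (Fin n) SignType) : Prop :=
  (∀ i : Fin n, A i (i + 1) = 1) ∨ (∀ i : Fin n, A (i + 1) i = 1)

/-- For a cycle-form pattern, `D(A_-)` contains a directed cycle of length `n`. -/
def MinusNCycle {n : ℕ} [NeZero n] (A : Matrix (Fin n) (Fin n) SignType) : Prop :=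
  (∀ i : Fin n, A i (i + 1) = -1) ∨ (∀ i : Fin n, A (i + 1) i = -1)

/-- A real matrix supported on the diagonal and the two arcs between consecutive indices modulo
`n`, with positive forward arcs, nonpositive backward arcs, and a maximal diagonal entry at an
index `p` that lies on no backward arc. -/
structure IsForwardCycle {n : ℕ} [NeZero n] (B : Matrix (Fin n) (Fin n) ℝ) (p : Fin n) : Prop where
  eq_zero : ∀ i j : Fin n, i ≠ j → j ≠ i + 1 → i ≠ j + 1 → B i j = 0
  forward_pos : ∀ i : Fin n, 0 < B i (i + 1)
  backward_nonpos : ∀ i : Fin n, B (i + 1) i ≤ 0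
  diag_le : ∀ i : Fin n, B i i ≤ B p p
  backward_to : ∀ i : Fin n, i + 1 = p → B p i = 0
  backward_from : B (p + 1) p = 0

theorem Fin.one_ne_zero_and_one_add_one_ne_zero {n : ℕ} [NeZero n] (hn : 3 ≤ n) :
    (1 : Fin n) ≠ 0 ∧ (1 + 1 : Fin n) ≠ 0 := by
  obtain ⟨m, rfl⟩ := Nat.exists_eq_add_of_le' hn
  refine ⟨by simp, ?_⟩
  rw [Ne, Fin.ext_iff, Fin.val_add, Fin.val_one', Nat.mod_eq_of_lt (show 1 < m + 3 by omega),
    Nat.mod_eq_of_lt (by omega)]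
  simp

theorem Fin.val_nsmul_one {n : ℕ} [NeZero n] (k : ℕ) : (k • (1 : Fin n)).val = k % n := by
  open scoped Fin.CommRing in
  rw [nsmul_one, Fin.val_natCast]

theorem Fin.nsmul_one_val {n : ℕ} [NeZero n] (i : Fin n) : i.val • (1 : Fin n) = i := by
  apply Fin.ext
  rw [Fin.val_nsmul_one, Nat.mod_eq_of_lt i.isLt]

namespace IsForwardCycle

variable {n : ℕ} [NeZero n] {B : Matrix (Fin n) (Fin n) ℝ} {p : Fin n}

/-- Transposing and reversing the cyclic order preserves the shape of the matrix. -/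
theorem reverse (h : IsForwardCycle B p) :
    IsForwardCycle (Matrix.of fun i j => B (-j) (-i)) (-p) where
  eq_zero i j h1 h2 h3 := by
    refine h.eq_zero _ _ (fun e => h1 (neg_injective e).symm) (fun e => h2 ?_) (fun e => h3 ?_)
    · rw [← neg_inj, neg_add, e]; abel
    · rw [← neg_inj, neg_add, e]; abel
  forward_pos i := by
    have := h.forward_pos (-(i + 1))
    rwa [show -(i + 1) + 1 = -i by abel] at this
  backward_nonpos i := by
    have := h.backward_nonpos (-(i + 1))
    rwa [show -(i + 1) + 1 = -i by abel] at this
  diag_le i := by simpa using h.diag_le (-i)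
  backward_to i hi := by
    have e : -i = p + 1 := by rw [← neg_inj, neg_add, ← hi]; abel
    simpa [e] using h.backward_from
  backward_from := by
    simpa using h.backward_to (-(-p + 1)) (by abel)

theorem mulVec_add_one (hn : 3 ≤ n) (h : IsForwardCycle B p) (v : Fin n → ℝ) (i : Fin n) :
    (B *ᵥ v) (i + 1) =
      B (i + 1) i * v i + B (i + 1) (i + 1) * v (i + 1) +
        B (i + 1) (i + 1 + 1) * v (i + 1 + 1) := by
  obtain ⟨h1, h2⟩ := Fin.one_ne_zero_and_one_add_one_ne_zero hn
  have e1 : i ≠ i + 1 := fun e => h1 (by simpa using e)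
  have e2 : i ≠ i + 1 + 1 := fun e => h2 (by simpa [add_assoc] using e)
  have e3 : i + 1 ≠ i + 1 + 1 := fun e => h1 (by simpa using e)
  have hs : ∑ j ∈ ({i, i + 1, i + 1 + 1} : Finset (Fin n)), B (i + 1) j * v j =
      ∑ j, B (i + 1) j * v j := by
    refine Finset.sum_subset (Finset.subset_univ _) fun j _ hj => ?_
    simp only [Finset.mem_insert, Finset.mem_singleton, not_or] at hj
    rw [h.eq_zero (i + 1) j (Ne.symm hj.2.1) hj.2.2 (fun e => hj.1 (add_right_cancel e).symm),
      zero_mul]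
  rw [Matrix.mulVec, dotProduct, ← hs, Finset.sum_insert (by simp [e1, e2]),
    Finset.sum_insert (by simp [e3]), Finset.sum_singleton, ← add_assoc]

theorem mulVec_self (hn : 3 ≤ n) (h : IsForwardCycle B p) (v : Fin n → ℝ) :
    (B *ᵥ v) p = B p p * v p + B p (p + 1) * v (p + 1) := by
  have := h.mulVec_add_one hn v (p - 1)
  rw [sub_add_cancel, h.backward_to (p - 1) (sub_add_cancel _ _)] at this
  rw [this]; ring

theorem forall_eq_zero_of_mulVec_eq (hn : 3 ≤ n) (h : IsForwardCycle B p) {lam : ℝ}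
    {v : Fin n → ℝ} (hv : B *ᵥ v = lam • v) (h0 : v p = 0) (i : Fin n) : v i = 0 := by
  have key : ∀ k : ℕ, v (p + k • 1) = 0 ∧ v (p + (k + 1) • 1) = 0 := by
    intro k
    induction k with
    | zero =>
      refine ⟨by simpa using h0, ?_⟩
      have := h.mulVec_self hn v
      rw [hv, Pi.smul_apply, h0] at this
      simpa [(h.forward_pos p).ne'] using this
    | succ k ih =>
      refine ⟨ih.2, ?_⟩
      have := h.mulVec_add_one hn v (p + k • 1)
      have e : p + k • 1 + 1 = p + (k + 1) • (1 : Fin n) := by rw [succ_nsmul, add_assoc]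
      have e' : p + (k + 1) • 1 + 1 = p + (k + 1 + 1) • (1 : Fin n) := by
        rw [succ_nsmul _ (k + 1), add_assoc]
      rw [hv, Pi.smul_apply, e, ih.1, ih.2, e'] at this
      have hp := h.forward_pos (p + (k + 1) • 1)
      rw [e'] at hp
      simpa [hp.ne'] using this
  have := (key (i - p).val).1
  rwa [Fin.nsmul_one_val, add_sub_cancel] at this

theorem forall_pos_of_mulVec_eq (hn : 3 ≤ n) (h : IsForwardCycle B p) {lam : ℝ}
    (hlam : B p p < lam) {v : Fin n → ℝ} (hv : B *ᵥ v = lam • v) (h0 : 0 < v p) (i : Fin n) :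
    0 < v i := by
  have key : ∀ k : ℕ, 0 < v (p + k • 1) ∧ 0 < v (p + (k + 1) • 1) := by
    intro k
    induction k with
    | zero =>
      refine ⟨by simpa using h0, ?_⟩
      have := h.mulVec_self hn v
      rw [hv, Pi.smul_apply, smul_eq_mul] at this
      have h1 : 0 < B p (p + 1) * v (p + 1) := by nlinarith
      simpa using pos_of_mul_pos_right h1 (h.forward_pos p).le
    | succ k ih =>
      refine ⟨ih.2, ?_⟩
      have := h.mulVec_add_one hn v (p + k • 1)
      have hb := h.backward_nonpos (p + k • 1)
      have e : p + k • 1 + 1 = p + (k + 1) • (1 : Fin n) := by rw [succ_nsmul, add_assoc]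
      have e' : p + (k + 1) • 1 + 1 = p + (k + 1 + 1) • (1 : Fin n) := by
        rw [succ_nsmul _ (k + 1), add_assoc]
      rw [hv, Pi.smul_apply, smul_eq_mul, e, e'] at this
      rw [e] at hb
      have hp := h.forward_pos (p + (k + 1) • 1)
      rw [e'] at hp
      have hd := h.diag_le (p + (k + 1) • 1)
      have h1 := mul_nonneg_of_nonpos_of_nonpos hb (neg_nonpos.2 ih.1.le)
      have h2 := mul_pos (sub_pos.2 (hd.trans_lt hlam)) ih.2
      exact pos_of_mul_pos_right (by linarith) hp.le
  have := (key (i - p).val).1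
  rwa [Fin.nsmul_one_val, add_sub_cancel] at this

/-- An eigenvector for an eigenvalue above the diagonal has entries of one strict sign. -/
theorem mul_pos_of_mulVec_eq (hn : 3 ≤ n) (h : IsForwardCycle B p) {lam : ℝ}
    (hlam : B p p < lam) {v : Fin n → ℝ} (hv : B *ᵥ v = lam • v) {i : Fin n} (hi : v i ≠ 0)
    (j : Fin n) : 0 < v i * v j := by
  rcases lt_trichotomy (v p) 0 with h0 | h0 | h0
  · have hv' : B *ᵥ (-v) = lam • (-v) := by rw [Matrix.mulVec_neg, hv, smul_neg]
    have key := h.forall_pos_of_mulVec_eq hn hlam hv' (by simpa using h0)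
    simpa using mul_pos (key i) (key j)
  · exact absurd (h.forall_eq_zero_of_mulVec_eq hn hv h0 i) hi
  · have key := h.forall_pos_of_mulVec_eq hn hlam hv h0
    exact mul_pos (key i) (key j)

theorem mul_pos_of_vecMul_eq (hn : 3 ≤ n) (h : IsForwardCycle B p) {lam : ℝ}
    (hlam : B p p < lam) {v : Fin n → ℝ} (hv : v ᵥ* B = lam • v) {i : Fin n} (hi : v i ≠ 0)
    (j : Fin n) : 0 < v i * v j := by
  have hw : (Matrix.of fun i j => B (-j) (-i)) *ᵥ (fun i => v (-i)) =
      lam • fun i => v (-i) := by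
    ext k
    have := congrFun hv (-k)
    simp only [Matrix.vecMul, dotProduct, Pi.smul_apply] at this
    simp only [Matrix.mulVec, dotProduct, Pi.smul_apply, Matrix.of_apply]
    rw [← this, ← Equiv.sum_comp (Equiv.neg (Fin n))]
    simp [mul_comm]
  have := h.reverse.mul_pos_of_mulVec_eq hn (by simpa using hlam) hw (i := -i)
    (by simpa using hi) (-j)
  simpa using this

/-- The solution of the eigenvector equation read forward along the cycle from `p`. -/
noncomputable def forwardSeq (B : Matrix (Fin n) (Fin n) ℝ) (p : Fin n) (lam : ℝ) : ℕ → ℝ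
  | 0 => 1
  | 1 => (lam - B p p) / B p (p + 1)
  | k + 2 => ((lam - B (p + (k + 1) • 1) (p + (k + 1) • 1)) * forwardSeq B p lam (k + 1) -
      B (p + (k + 1) • 1) (p + k • 1) * forwardSeq B p lam k) /
        B (p + (k + 1) • 1) (p + (k + 1) • 1 + 1)

theorem continuous_forwardSeq (B : Matrix (Fin n) (Fin n) ℝ) (p : Fin n) (k : ℕ) :
    Continuous fun lam => forwardSeq B p lam k := by
  induction k using Nat.twoStepInduction with
  | zero => simp only [forwardSeq]; fun_prop
  | one => simp only [forwardSeq]; fun_prop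
  | more k h0 h1 => simp only [forwardSeq]; fun_prop

theorem forwardSeq_diag (h : IsForwardCycle B p) (k : ℕ) :
    forwardSeq B p (B p p) (k + 1) = 0 := by
  induction k using Nat.twoStepInduction with
  | zero => simp [forwardSeq]
  | one => simp [forwardSeq, h.backward_from]
  | more k h0 h1 => rw [forwardSeq, h0, h1]; simp

theorem forwardSeq_le_succ (h : IsForwardCycle B p) {lam : ℝ}
    (hlam : ∀ i, B i (i + 1) ≤ lam - B p p) (k : ℕ) :
    0 < forwardSeq B p lam k ∧ forwardSeq B p lam k ≤ forwardSeq B p lam (k + 1) := by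
  induction k with
  | zero =>
    refine ⟨one_pos, ?_⟩
    simp only [forwardSeq]
    rw [le_div_iff₀ (h.forward_pos p), one_mul]
    exact hlam p
  | succ k ih =>
    have hpos := ih.1.trans_le ih.2
    refine ⟨hpos, ?_⟩
    rw [forwardSeq, le_div_iff₀ (h.forward_pos _)]
    have hb := h.backward_nonpos (p + k • 1)
    rw [show p + k • 1 + 1 = p + (k + 1) • (1 : Fin n) by rw [succ_nsmul, add_assoc]] at hb
    have hd := h.diag_le (p + (k + 1) • 1)
    have h1 := mul_nonneg_of_nonpos_of_nonpos hb (neg_nonpos.2 ih.1.le)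
    have h2 := mul_le_mul_of_nonneg_left
      ((hlam (p + (k + 1) • 1)).trans (sub_le_sub_left hd lam)) hpos.le
    linarith

theorem exists_forwardSeq_eq_one (h : IsForwardCycle B p) :
    ∃ lam, B p p < lam ∧ forwardSeq B p lam n = 1 := by
  have hlam : ∀ i, B i (i + 1) ≤ (B p p + ∑ i, B i (i + 1)) - B p p := fun i => by
    rw [add_sub_cancel_left]
    exact Finset.single_le_sum (f := fun i => B i (i + 1))
      (fun i _ => (h.forward_pos i).le) (Finset.mem_univ i)
  have hmono := monotone_nat_of_le_succ fun k => (h.forwardSeq_le_succ hlam k).2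
  have hzero : forwardSeq B p (B p p) n = 0 := by
    obtain ⟨m, hm⟩ := Nat.exists_eq_succ_of_ne_zero (NeZero.ne n)
    have := h.forwardSeq_diag m
    rwa [← Nat.succ_eq_add_one, ← hm] at this
  obtain ⟨lam, hmem, heq⟩ := intermediate_value_Icc
    (le_add_of_nonneg_right (Finset.sum_nonneg fun i _ => (h.forward_pos i).le))
    (continuous_forwardSeq B p n).continuousOn
    (show (1 : ℝ) ∈ Set.Icc _ _ from ⟨by simp [hzero], hmono (Nat.zero_le n)⟩)
  refine ⟨lam, lt_of_le_of_ne hmem.1 ?_, heq⟩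
  rintro rfl
  simp [hzero] at heq

theorem exists_mulVec_eq (hn : 3 ≤ n) (h : IsForwardCycle B p) :
    ∃ lam, B p p < lam ∧ ∃ v : Fin n → ℝ, v ≠ 0 ∧ B *ᵥ v = lam • v := by
  obtain ⟨lam, hlt, hone⟩ := h.exists_forwardSeq_eq_one
  obtain ⟨v, hv⟩ : ∃ v : Fin n → ℝ, ∀ i, v i = forwardSeq B p lam (i - p).val := ⟨_, fun _ => rfl⟩
  have hvp : v p = 1 := by rw [hv, sub_self, Fin.val_zero, forwardSeq]
  have hvk : ∀ k ≤ n, v (p + k • 1) = forwardSeq B p lam k := by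
    intro k hk
    rw [hv, add_sub_cancel_left, Fin.val_nsmul_one]
    rcases hk.lt_or_eq with hk | rfl
    · rw [Nat.mod_eq_of_lt hk]
    · rw [Nat.mod_self, hone, forwardSeq]
  refine ⟨lam, hlt, v, fun e => by simp [e] at hvp, ?_⟩
  have key : ∀ k < n, (B *ᵥ v) (p + k • 1) = lam * v (p + k • 1) := by
    intro k hk
    cases k with
    | zero =>
      have h1 := hvk 1 (by omega)
      rw [one_nsmul, forwardSeq] at h1
      rw [zero_nsmul, add_zero, h.mulVec_self hn, h1, hvp, mul_div_cancel₀ _ (h.forward_pos p).ne']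
      ring
    | succ k =>
      have e : p + k • 1 + 1 = p + (k + 1) • (1 : Fin n) := by rw [succ_nsmul, add_assoc]
      have e' : p + (k + 1) • 1 + 1 = p + (k + 2) • (1 : Fin n) := by
        rw [succ_nsmul _ (k + 1), add_assoc]
      have h2 := hvk (k + 2) (by omega)
      rw [forwardSeq, ← hvk k (by omega), ← hvk (k + 1) (by omega),
        eq_div_iff (h.forward_pos _).ne', ← e'] at h2
      rw [← e, h.mulVec_add_one hn, e]
      linarith
  ext i
  have := key (i - p).val (i - p).isLt
  rwa [Fin.nsmul_one_val, add_sub_cancel] at this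

theorem algPositive (hn : 3 ≤ n) (h : IsForwardCycle B p) : AlgPositive B := by
  obtain ⟨lam, hlt, v, hv0, hv⟩ := h.exists_mulVec_eq hn
  have hroot : (minpoly ℝ B).IsRoot lam := by
    rw [← Matrix.minpoly_toLin']
    refine Module.End.isRoot_of_hasEigenvalue (Module.End.hasEigenvalue_of_hasEigenvector
      (x := v) ⟨Module.End.mem_eigenspace_iff.2 ?_, hv0⟩)
    rw [Matrix.toLin'_apply, hv]
  obtain ⟨g, hg⟩ := Polynomial.dvd_iff_isRoot.2 hroot
  have hB : IsIntegral ℝ B := Algebra.IsIntegral.isIntegral B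
  have hg0 : g ≠ 0 := by
    rintro rfl
    exact minpoly.ne_zero hB (by rw [hg, mul_zero])
  have hgB : Polynomial.aeval B g ≠ 0 := by
    intro e
    have hdvd := minpoly.dvd ℝ B e
    rw [hg, ← one_mul g, ← mul_assoc, mul_one] at hdvd
    exact Polynomial.not_isUnit_X_sub_C lam (isUnit_of_dvd_one ((mul_dvd_mul_iff_right hg0).1 hdvd))
  have hzero : Polynomial.aeval B ((Polynomial.X - Polynomial.C lam) * g) = 0 := by
    rw [← hg, minpoly.aeval]
  set G := Polynomial.aeval B g with hG
  have hleft : B * G = lam • G := by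
    rw [map_mul, map_sub, Polynomial.aeval_X, Polynomial.aeval_C, sub_mul,
      Algebra.algebraMap_eq_smul_one, smul_mul_assoc, one_mul, sub_eq_zero] at hzero
    exact hzero
  have hright : G * B = lam • G := by
    rw [mul_comm, map_mul, map_sub, Polynomial.aeval_X, Polynomial.aeval_C, mul_sub,
      Algebra.algebraMap_eq_smul_one, mul_smul_comm, mul_one, sub_eq_zero] at hzero
    exact hzero
  obtain ⟨a, b, hab⟩ : ∃ a b, G a b ≠ 0 := by
    by_contra! hne
    exact hgB (Matrix.ext hne)
  have hcol : ∀ i, 0 < G a b * G i b := fun i =>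
    h.mul_pos_of_mulVec_eq hn hlt (v := fun k => G k b)
      (funext fun k => congrFun (congrFun hleft k) b) hab i
  have hrow : ∀ i j, 0 < G i b * G i j := fun i j =>
    h.mul_pos_of_vecMul_eq hn hlt (v := G i) (congrFun hright i)
      (right_ne_zero_of_mul (hcol i).ne') j
  refine ⟨Polynomial.C (G a b) * g, fun i j => ?_⟩
  rw [map_mul, Polynomial.aeval_C, Algebra.algebraMap_eq_smul_one, smul_mul_assoc, one_mul, ← hG,
    Matrix.smul_apply, smul_eq_mul]
  have h1 := mul_pos (hcol i) (hrow i j)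
  have h2 : 0 < G i b ^ 2 := by
    have := right_ne_zero_of_mul (hcol i).ne'
    positivity
  exact pos_of_mul_pos_right (show 0 < G i b ^ 2 * (G a b * G i j) by linarith) h2.le

end IsForwardCycle

/-- Cycle-form `A` with all directed 2-cycles negative and
`a_{i,i+1} = +` for all `i` (mod `n`): if `a_{ii} ∈ {-,0}` for every vertex covered
by a negative directed 2-cycle and `a_{ii} = +` for some `i`, then `A` requires
algebraic positivity. -/
theorem stmt_15 {n : ℕ} [NeZero n] (hn : 3 ≤ n) (A : Matrix (Fin n) (Fin n) SignType)
    (hcyc : CycleForm A)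
    (hneg2 : ∀ i j : Fin n, i ≠ j → A i j ≠ 0 → A j i ≠ 0 → A i j * A j i = -1)
    (hsup : ∀ i : Fin n, A i (i + 1) = 1)
    (hcov : ∀ i : Fin n, (∃ j : Fin n, j ≠ i ∧ A i j * A j i = -1) → A i i ≠ 1)
    (hpos : ∃ i : Fin n, A i i = 1) :
    RequiresAP A := by
  intro B hB
  have h1 : (1 : Fin n) ≠ 0 := (Fin.one_ne_zero_and_one_add_one_ne_zero hn).1
  have hne : ∀ i : Fin n, i + 1 ≠ i := fun i e => h1 (by simpa using e)
  have hzero : ∀ i j, A i j = 0 → B i j = 0 := fun i j e => by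
    rwa [← sign_eq_zero_iff, hB i j]
  have hback : ∀ i, A (i + 1) i ≠ 0 → A (i + 1) i = -1 := fun i e => by
    have := hneg2 i (i + 1) (hne i).symm (by simp [hsup i]) e
    rwa [hsup i, one_mul] at this
  obtain ⟨p, hp⟩ := Finite.exists_max fun i => B i i
  have hApp : A p p = 1 := by
    obtain ⟨i, hi⟩ := hpos
    rw [← hB i i, sign_eq_one_iff] at hi
    rw [← hB p p, sign_eq_one_iff]
    exact hi.trans_le (hp i)
  refine IsForwardCycle.algPositive (p := p) hn ⟨?_, ?_, ?_, hp, ?_, ?_⟩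
  · exact fun i j e1 e2 e3 => hzero i j (hcyc.1 i j e1 e2 e3)
  · exact fun i => sign_eq_one_iff.1 ((hB _ _).trans (hsup i))
  · intro i
    by_cases e : A (i + 1) i = 0
    · exact (hzero _ _ e).le
    · exact (sign_eq_neg_one_iff.1 ((hB _ _).trans (hback i e))).le
  · rintro i rfl
    refine hzero _ _ (by_contra fun e => hcov (i + 1) ⟨i, (hne i).symm, ?_⟩ hApp)
    rw [hback i e, hsup i]; rfl
  · refine hzero _ _ (by_contra fun e => hcov p ⟨p + 1, hne p, ?_⟩ hApp)
    rw [hback p e, hsup p]; rfl
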